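/- Let n ≥ 2 and suppose s = −((n−1)/2)·r'. Then the coefficient function K n 2 satisfies K n 2 = (1/4) · binom(n+1, 3) · r^{n−2} · ( (r')² − 2·r·r'' ), where r' and r'' are the first and second derivatives of r and r^{n−2} denotes the pointwise (n−2)-th power of r. Equivalently, if r is nonvanishing, the coefficient A_n^2 = K n 2 / r^n equals binom(n+1, 3) · ((r')² − 2 r r'')/(4 r²). -/

import Mathlib

/-- The first-order differential operator `Ψ y = r·y' + s·y`. -/
noncomputable def Psi (r s : ℝ → ℝ) (y : ℝ → ℝ) : ℝ → ℝ :=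
  fun x => r x * deriv y x + s x * y x


/-- The coefficient functions `K n j` of the iterative equation, defined by the
recurrence `K 0 0 = 1`, `K m j = 0` for `j > m`,
`K n j = r · K (n-1) j + Ψ (K (n-1) (j-1))` for `n ≥ 1`, `1 ≤ j ≤ n`,
and `K n 0 = r · K (n-1) 0` for `n ≥ 1`. -/
noncomputable def K (r s : ℝ → ℝ) : ℕ → ℕ → ℝ → ℝ
  | 0, 0 => fun _ => 1
  | 0, _ + 1 => fun _ => 0
  | n + 1, 0 => fun x => r x * K r s n 0 x
  | n + 1, j + 1 => fun x => r x * K r s n (j + 1) x + Psi r s (K r s n j) x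


/-- `K m 0 = r ^ m`. -/
theorem K_zero_right (r s : ℝ → ℝ) (m : ℕ) : K r s m 0 = fun x => r x ^ m := by
  induction m with
  | zero => funext x; simp [K]
  | succ m ih => funext x; simp only [K, ih]; ring

/-- For `s = c·r'` with `c` constant, `K (m+1) 1` is a multiple of `r ^ m · r'`. -/
theorem K_succ_one {r : ℝ → ℝ} (hr : Differentiable ℝ r) (c : ℝ) (m : ℕ) :
    K r (fun x => c * deriv r x) (m + 1) 1 =
      fun x => ((m : ℝ) + 1) * (c + m / 2) * (r x ^ m * deriv r x) := by
  induction m with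
  | zero => funext x; simp [K, Psi]
  | succ m ih =>
    funext x
    have hd : deriv (fun y => r y ^ (m + 1)) x = ((m : ℝ) + 1) * r x ^ m * deriv r x := by
      simpa using ((hr x).hasDerivAt.fun_pow (m + 1)).deriv
    rw [K, ih, K_zero_right]
    simp only [Psi, hd]
    push_cast
    ring

/-- For `s = c·r'` with `c` constant, `K (m+2) 2` is a combination of `r ^ m · (r')²` and
`r ^ (m+1) · r''`. -/
theorem K_add_two_two {r : ℝ → ℝ} (hr : Differentiable ℝ r) (hr' : Differentiable ℝ (deriv r))
    (c : ℝ) (m : ℕ) :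
    K r (fun x => c * deriv r x) (m + 2) 2 =
      fun x => ((m : ℝ) + 2) * (m + 1) *
        ((c ^ 2 / 2 + c * m / 2 + m * (m - 1) / 8 + m / 6) * (r x ^ m * deriv r x ^ 2) +
          (c / 2 + m / 6) * (r x ^ (m + 1) * deriv (deriv r) x)) := by
  have hd (k : ℕ) (x : ℝ) : deriv (K r (fun x => c * deriv r x) (k + 1) 1) x =
      ((k : ℝ) + 1) * (c + k / 2) *
        (k * r x ^ (k - 1) * deriv r x * deriv r x + r x ^ k * deriv (deriv r) x) := by
    rw [K_succ_one hr]
    exact ((((hr x).hasDerivAt.pow k).mul (hr' x).hasDerivAt).const_mul _).deriv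
  have step (k : ℕ) (x : ℝ) : K r (fun x => c * deriv r x) (k + 2) 2 x =
      r x * K r (fun x => c * deriv r x) (k + 1) 2 x +
        (r x * deriv (K r (fun x => c * deriv r x) (k + 1) 1) x +
          c * deriv r x * K r (fun x => c * deriv r x) (k + 1) 1 x) := rfl
  induction m with
  | zero =>
    funext x
    have h : K r (fun x => c * deriv r x) (0 + 1) 2 x = 0 := by simp [K, Psi]
    rw [step, h, hd, K_succ_one hr]
    simp
    ring
  | succ m ih =>
    funext x
    rw [step, ih, hd, K_succ_one hr]
    simp only [Nat.add_sub_cancel]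
    push_cast
    ring

theorem cast_choose_three (m : ℕ) :
    ((m + 3).choose 3 : ℝ) = ((m : ℝ) + 3) * (m + 2) * (m + 1) / 6 := by
  rw [Nat.cast_choose_eq_ascPochhammer_div]
  simp [ascPochhammer_succ_right, Nat.factorial]
  ring

/-- for `n ≥ 2` and `s = −((n−1)/2)·r'`,
`K n 2 = (1/4)·binom(n+1,3)·r^{n−2}·((r')² − 2·r·r'')`; equivalently, if `r` is
nonvanishing, `A_n^2 = K n 2 / r^n = binom(n+1,3)·((r')² − 2 r r'')/(4 r²)`. -/
theorem coeff_K_n_two_normal (r : ℝ → ℝ) (hr : ContDiff ℝ (⊤ : ℕ∞) r)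
    (n : ℕ) (hn : 2 ≤ n) (s : ℝ → ℝ)
    (hs : s = fun x => -(((n : ℝ) - 1) / 2) * deriv r x) :
    (K r s n 2 = fun x =>
      (1 / 4) * ((n + 1).choose 3 : ℝ) * r x ^ (n - 2) *
        ((deriv r x) ^ 2 - 2 * r x * iteratedDeriv 2 r x)) ∧
    ((∀ x, r x ≠ 0) → ∀ x,
      K r s n 2 x / r x ^ n =
        ((n + 1).choose 3 : ℝ) *
          ((deriv r x) ^ 2 - 2 * r x * iteratedDeriv 2 r x) / (4 * r x ^ 2)) := by
  have key : K r s n 2 = fun x =>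
      (1 / 4) * ((n + 1).choose 3 : ℝ) * r x ^ (n - 2) *
        ((deriv r x) ^ 2 - 2 * r x * iteratedDeriv 2 r x) := by
    obtain ⟨m, rfl⟩ := Nat.exists_eq_add_of_le' hn
    have hr' : Differentiable ℝ (deriv r) :=
      ((contDiff_infty_iff_deriv.1 hr).2).differentiable (by simp)
    rw [hs, K_add_two_two (hr.differentiable (by simp)) hr']
    funext x
    rw [cast_choose_three, iteratedDeriv_succ, iteratedDeriv_one, Nat.add_sub_cancel]
    push_cast
    ring
  refine ⟨key, fun h x => ?_⟩
  obtain ⟨m, rfl⟩ := Nat.exists_eq_add_of_le' hn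
  have hx := h x
  rw [key, Nat.add_sub_cancel, pow_add]
  field_simp
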